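/- arXiv:2604.01799 — 4 statements merged into one kernel-verified Lean document; each statement's English description precedes it below -/
import Mathlib

section
/- Let V be a finite set and f : Finset V → ℝ a function with f(∅) = 0 that is monotone (A ⊆ B → f(A) ≤ f(B)) and submodular (for A ⊆ B and x ∉ B, f(B ∪ {x}) − f(B) ≤ f(A ∪ {x}) − f(A)). Fix K ≥ 1 and define the greedy sequence S₀ = ∅ and S_t = S_{t−1} ∪ {a_t}, where a_t is any element maximizing the marginal gain f(S_{t−1} ∪ {a}) − f(S_{t−1}) over a ∈ V. Then the greedy suite after K steps satisfies f(S_K) ≥ (1 − 1/e) · max { f(T) : T ⊆ V, |T| ≤ K }. -/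
theorem submodular_union_sub_le_sum_marginal {V : Type*} [DecidableEq V]
    (f : Finset V → ℝ)
    (hsub : ∀ A B : Finset V, A ⊆ B → ∀ x : V, x ∉ B →
      f (insert x B) - f B ≤ f (insert x A) - f A)
    (A T : Finset V) :
    f (A ∪ T) - f A ≤ ∑ x ∈ T, (f (insert x A) - f A) := by
  induction T using Finset.induction_on with
  | empty => simp
  | insert x T hxT ih =>
    rw [Finset.sum_insert hxT, Finset.union_insert]
    by_cases hx : x ∈ A ∪ T
    · have hxA : x ∈ A := (Finset.mem_union.mp hx).resolve_right hxT
      rw [Finset.insert_eq_of_mem hx, Finset.insert_eq_of_mem hxA]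
      linarith
    · linarith [hsub A (A ∪ T) Finset.subset_union_left x hx]

/-- If every marginal gain at `A` is at most `δ ≥ 0`, then a set of at most `K` elements
improves on `A` by at most `K * δ`. -/
theorem submodular_sub_le_mul_of_marginal_le {V : Type*} [DecidableEq V]
    (f : Finset V → ℝ)
    (hmono : ∀ A B : Finset V, A ⊆ B → f A ≤ f B)
    (hsub : ∀ A B : Finset V, A ⊆ B → ∀ x : V, x ∉ B →
      f (insert x B) - f B ≤ f (insert x A) - f A)
    {A T : Finset V} {K : ℕ} {δ : ℝ} (hδ : 0 ≤ δ)
    (hA : ∀ x, f (insert x A) - f A ≤ δ) (hT : T.card ≤ K) :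
    f T - f A ≤ K * δ := by
  calc f T - f A ≤ f (A ∪ T) - f A := by
        linarith [hmono T (A ∪ T) Finset.subset_union_right]
    _ ≤ ∑ x ∈ T, (f (insert x A) - f A) :=
        submodular_union_sub_le_sum_marginal f hsub A T
    _ ≤ T.card * δ := by
        simpa using Finset.sum_le_card_nsmul T _ δ fun x _ => hA x
    _ ≤ K * δ := by gcongr

/-- Greedy maximization of a monotone submodular set function `f` with
`f ∅ = 0`: after `K ≥ 1` greedy steps (each adding an element of maximal
marginal gain), the value `f(S_K)` is at least `(1 − 1/e)` times the value of
any suite of at most `K` elements, hence at least `(1 − 1/e)` times the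
optimum. -/
theorem greedy_submodular_approximation {V : Type*} [Fintype V] [DecidableEq V]
    (f : Finset V → ℝ) (hf0 : f ∅ = 0)
    (hmono : ∀ A B : Finset V, A ⊆ B → f A ≤ f B)
    (hsub : ∀ A B : Finset V, A ⊆ B → ∀ x : V, x ∉ B →
      f (insert x B) - f B ≤ f (insert x A) - f A)
    (K : ℕ) (hK : 1 ≤ K)
    (a : ℕ → V) (S : ℕ → Finset V)
    (hS0 : S 0 = ∅)
    (hstep : ∀ t : ℕ, S (t + 1) = insert (a (t + 1)) (S t))
    (hgreedy : ∀ t : ℕ, ∀ b : V,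
      f (insert b (S t)) - f (S t) ≤ f (insert (a (t + 1)) (S t)) - f (S t)) :
    ∀ T : Finset V, T.card ≤ K →
      (1 - 1 / Real.exp 1) * f T ≤ f (S K) := by
  intro T hT
  have hK0 : (0 : ℝ) < K := by exact_mod_cast hK
  have hq : (0 : ℝ) ≤ 1 - 1 / K := by
    rw [sub_nonneg, div_le_one hK0]
    exact_mod_cast hK
  have gap_step (t : ℕ) : f T - f (S (t + 1)) ≤ (1 - 1 / K) * (f T - f (S t)) := by
    have h := submodular_sub_le_mul_of_marginal_le f hmono hsub
      (sub_nonneg.mpr (hmono _ _ (Finset.subset_insert (a (t + 1)) (S t)))) (hgreedy t) hT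
    rw [← hstep, ← div_le_iff₀' hK0] at h
    have : (1 - 1 / K) * (f T - f (S t)) = f T - f (S t) - (f T - f (S t)) / K := by ring
    linarith
  have gap_pow (t : ℕ) : f T - f (S t) ≤ (1 - 1 / K) ^ t * f T := by
    induction t with
    | zero => simp [hS0, hf0]
    | succ t ih =>
      calc f T - f (S (t + 1)) ≤ (1 - 1 / K) * (f T - f (S t)) := gap_step t
        _ ≤ (1 - 1 / K) * ((1 - 1 / K) ^ t * f T) := mul_le_mul_of_nonneg_left ih hq
        _ = (1 - 1 / K) ^ (t + 1) * f T := by ring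
  have hfT : 0 ≤ f T := hf0 ▸ hmono ∅ T (Finset.empty_subset T)
  have hexp : (1 - 1 / K : ℝ) ^ K ≤ 1 / Real.exp 1 := by
    rw [one_div (Real.exp 1), ← Real.exp_neg]
    exact Real.one_sub_div_pow_le_exp_neg (by exact_mod_cast hK)
  linarith [gap_pow K, mul_le_mul_of_nonneg_right hexp hfT]
end

section
/- Let V be a finite set of test cases, E a finite set of structural elements, and Check : V → Finset E. Define F(S) = |⋃_{t ∈ S} Check(t)| for S ⊆ V. Fix K ≥ 1 and define the greedy sequence S₀ = ∅ and S_t = S_{t−1} ∪ {a_t}, where a_t maximizes F(S_{t−1} ∪ {a}) − F(S_{t−1}) over a ∈ V. Then F(S_K) ≥ (1 − 1/e) · max { F(T) : T ⊆ V, |T| ≤ K }; that is, step-wise greedy test selection achieves at least a (1 − 1/e) fraction of the optimal coverage attainable with K tests. -/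
/-- Utility of a test suite: number of structural elements covered by the union
of the `Check` sets of its tests. -/
def coverageUtility {V E : Type*} [DecidableEq E] (Check : V → Finset E)
    (S : Finset V) : ℕ :=
  (S.biUnion Check).card

theorem coverageUtility_insert {V E : Type*} [DecidableEq V] [DecidableEq E]
    (Check : V → Finset E) (b : V) (S : Finset V) :
    coverageUtility Check (insert b S) =
      (Check b \ S.biUnion Check).card + coverageUtility Check S := by
  rw [coverageUtility, coverageUtility, Finset.biUnion_insert, Finset.card_sdiff_add_card]

theorem coverageUtility_le_add_sum {V E : Type*} [DecidableEq E]
    (Check : V → Finset E) (S T : Finset V) :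
    coverageUtility Check T ≤
      coverageUtility Check S + ∑ b ∈ T, (Check b \ S.biUnion Check).card := by
  have hsub : T.biUnion Check ⊆
      S.biUnion Check ∪ T.biUnion fun b => Check b \ S.biUnion Check := by
    intro x hx
    obtain ⟨b, hb, hxb⟩ := Finset.mem_biUnion.mp hx
    by_cases hxS : x ∈ S.biUnion Check
    · exact Finset.mem_union_left _ hxS
    · exact Finset.mem_union_right _
        (Finset.mem_biUnion.mpr ⟨b, hb, Finset.mem_sdiff.mpr ⟨hxb, hxS⟩⟩)
  exact (Finset.card_le_card hsub).trans
    ((Finset.card_union_le _ _).trans (Nat.add_le_add_left Finset.card_biUnion_le _))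

/-- If a sequence starting at a nonnegative value closes at least a `1 / K` fraction of its gap
to `M` at each step, then after `K` steps it is at least `(1 - 1 / e) * M`. -/
theorem one_sub_inv_exp_mul_le_of_gap_le {K : ℕ} (hK : 1 ≤ K) {f : ℕ → ℝ} {M : ℝ}
    (hM : 0 ≤ M) (h0 : 0 ≤ f 0) (hf : ∀ t, M - f t ≤ K * (f (t + 1) - f t)) :
    (1 - 1 / Real.exp 1) * M ≤ f K := by
  have hK1 : (1 : ℝ) ≤ K := by exact_mod_cast hK
  have hKpos : (0 : ℝ) < K := by linarith
  have hr : 0 ≤ 1 - 1 / (K : ℝ) := by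
    rw [sub_nonneg, div_le_one hKpos]
    exact hK1
  have hgap : ∀ t, M - f t ≤ (1 - 1 / (K : ℝ)) ^ t * M := by
    intro t
    induction t with
    | zero => simpa using h0
    | succ t ih =>
      have hdiv : (M - f t) / K ≤ f (t + 1) - f t := by
        rw [div_le_iff₀' hKpos]
        exact hf t
      calc M - f (t + 1) ≤ (M - f t) - (M - f t) / K := by linarith
        _ = (1 - 1 / (K : ℝ)) * (M - f t) := by ring
        _ ≤ (1 - 1 / (K : ℝ)) * ((1 - 1 / (K : ℝ)) ^ t * M) :=
          mul_le_mul_of_nonneg_left ih hr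
        _ = (1 - 1 / (K : ℝ)) ^ (t + 1) * M := by ring
  have hexp : (1 - 1 / (K : ℝ)) ^ K ≤ 1 / Real.exp 1 := by
    rw [one_div (Real.exp 1), ← Real.exp_neg]
    exact Real.one_sub_div_pow_le_exp_neg hK1
  linarith [hgap K, mul_le_mul_of_nonneg_right hexp hM]

/-- Greedy test selection for the coverage utility
`F(S) = |⋃_{t ∈ S} Check t|`: after `K ≥ 1` greedy steps (each adding a test
of maximal marginal coverage gain), the covered amount `F(S_K)` is at least
`(1 − 1/e)` times the coverage of any suite of at most `K` tests, hence at
least `(1 − 1/e)` of the optimal coverage attainable with `K` tests. -/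
theorem greedy_coverage_approximation {V E : Type*} [Fintype V] [DecidableEq V]
    [Fintype E] [DecidableEq E] (Check : V → Finset E)
    (K : ℕ) (hK : 1 ≤ K)
    (a : ℕ → V) (S : ℕ → Finset V)
    (hS0 : S 0 = ∅)
    (hstep : ∀ t : ℕ, S (t + 1) = insert (a (t + 1)) (S t))
    (hgreedy : ∀ t : ℕ, ∀ b : V,
      (coverageUtility Check (insert b (S t)) : ℝ) - coverageUtility Check (S t) ≤
        (coverageUtility Check (insert (a (t + 1)) (S t)) : ℝ) -
          coverageUtility Check (S t)) :
    ∀ T : Finset V, T.card ≤ K →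
      (1 - 1 / Real.exp 1) * (coverageUtility Check T : ℝ) ≤
        (coverageUtility Check (S K) : ℝ) := by
  intro T hT
  refine one_sub_inv_exp_mul_le_of_gap_le (f := fun t => (coverageUtility Check (S t) : ℝ)) hK
    (Nat.cast_nonneg _) (Nat.cast_nonneg _) fun t => ?_
  have hgain : ∀ b, (Check b \ (S t).biUnion Check).card ≤
      (Check (a (t + 1)) \ (S t).biUnion Check).card := by
    intro b
    have hb := hgreedy t b
    simpa [coverageUtility_insert] using hb
  have hcover : coverageUtility Check T ≤ coverageUtility Check (S t) +
      K * (Check (a (t + 1)) \ (S t).biUnion Check).card :=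
    (coverageUtility_le_add_sum Check (S t) T).trans <| Nat.add_le_add_left
      ((Finset.sum_le_card_nsmul _ _ _ fun b _ => hgain b).trans
        (Nat.mul_le_mul_right _ hT)) _
  have hcover' : (coverageUtility Check T : ℝ) ≤ coverageUtility Check (S t) +
      K * (Check (a (t + 1)) \ (S t).biUnion Check).card := by
    exact_mod_cast hcover
  simp only [hstep, coverageUtility_insert, Nat.cast_add, add_sub_cancel_right]
  linarith
end

section
/- Let V be a finite set and f : Finset V → ℝ monotone and submodular with f(∅) = 0. Then for any S, T ⊆ V, f(T) ≤ f(S) + Σ_{x ∈ T \ S} (f(S ∪ {x}) − f(S)); in particular, if |T| ≤ K there exists x ∈ V with f(S ∪ {x}) − f(S) ≥ (f(T) − f(S)) / K. -/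
/-- A set function with diminishing marginal gains grows, when `R` is adjoined to `S`, by at most
the sum of the marginal gains over `S` of the elements of `R`. -/
theorem le_add_sum_marginal_gains {V : Type*} [DecidableEq V] (f : Finset V → ℝ)
    (hsub : ∀ A B : Finset V, A ⊆ B → ∀ x : V, x ∉ B →
      f (insert x B) - f B ≤ f (insert x A) - f A) (S R : Finset V) :
    f (S ∪ R) ≤ f S + ∑ x ∈ R, (f (insert x S) - f S) := by
  induction R using Finset.induction_on with
  | empty => simp
  | insert x R hx ih =>
    rw [Finset.sum_insert hx, Finset.union_insert]
    by_cases hxS : x ∈ S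
    · rw [Finset.insert_eq_of_mem (Finset.mem_union_left R hxS), Finset.insert_eq_of_mem hxS]
      linarith
    · have h := hsub S (S ∪ R) Finset.subset_union_left x (by simp [hxS, hx])
      linarith


/-- Key per-step lemma for the greedy analysis: for a monotone submodular `f`
with `f ∅ = 0`, any target value `f T` is bounded by `f S` plus the sum of the
individual marginal gains of the elements of `T \ S`; in particular, if
`|T| ≤ K`, some single element closes at least a `1/K` fraction of the gap
`f T − f S`. -/
theorem submodular_sum_of_marginal_gains {V : Type*} [Fintype V] [DecidableEq V]
    [Nonempty V]
    (f : Finset V → ℝ) (hf0 : f ∅ = 0)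
    (hmono : ∀ A B : Finset V, A ⊆ B → f A ≤ f B)
    (hsub : ∀ A B : Finset V, A ⊆ B → ∀ x : V, x ∉ B →
      f (insert x B) - f B ≤ f (insert x A) - f A)
    (K : ℕ) (hK : 1 ≤ K) :
    ∀ S T : Finset V,
      (f T ≤ f S + ∑ x ∈ T \ S, (f (insert x S) - f S)) ∧
      (T.card ≤ K → ∃ x : V, (f T - f S) / K ≤ f (insert x S) - f S) := by
  intro S T
  have hsum : f T ≤ f S + ∑ x ∈ T \ S, (f (insert x S) - f S) := by
    refine (hmono T (S ∪ T \ S) ?_).trans (le_add_sum_marginal_gains f hsub S (T \ S))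
    rw [Finset.union_sdiff_self_eq_union]
    exact Finset.subset_union_right
  refine ⟨hsum, fun hT => ?_⟩
  by_contra! hlt
  obtain ⟨x₀⟩ := ‹Nonempty V›
  have hK0 : (0 : ℝ) < K := by exact_mod_cast hK
  have hpos : 0 < (f T - f S) / K :=
    (sub_nonneg.2 (hmono S _ (Finset.subset_insert x₀ S))).trans_lt (hlt x₀)
  have hgap : 0 < f T - f S := (div_pos_iff_of_pos_right hK0).1 hpos
  have hne : (T \ S).Nonempty := by
    by_contra h
    rw [Finset.not_nonempty_iff_eq_empty.1 h, Finset.sum_empty] at hsum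
    linarith
  have hcard : ((T \ S).card : ℝ) ≤ K := by
    exact_mod_cast (Finset.card_le_card Finset.sdiff_subset).trans hT
  have hbound : ∑ x ∈ T \ S, (f (insert x S) - f S) < f T - f S :=
    calc ∑ x ∈ T \ S, (f (insert x S) - f S)
        < ∑ _x ∈ T \ S, (f T - f S) / K := Finset.sum_lt_sum_of_nonempty hne fun x _ => hlt x
      _ = (T \ S).card * ((f T - f S) / K) := by rw [Finset.sum_const, nsmul_eq_mul]
      _ ≤ K * ((f T - f S) / K) := mul_le_mul_of_nonneg_right hcard hpos.le
      _ = f T - f S := mul_div_cancel₀ _ hK0.ne'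
  linarith
end

section
/- Let V be a finite set and f : Finset V → ℝ monotone and submodular with f(∅) = 0. Fix K ≥ 1, let OPT ⊆ V with |OPT| ≤ K, and let S₀ = ∅, S_t = S_{t−1} ∪ {a_t} be the greedy sequence where a_t maximizes the marginal gain f(S_{t−1} ∪ {a}) − f(S_{t−1}) over a ∈ V. Then for every t ≥ 1, f(OPT) − f(S_t) ≤ (1 − 1/K) · (f(OPT) − f(S_{t−1})), and consequently f(OPT) − f(S_K) ≤ (1 − 1/K)^K · f(OPT). -/
/-- For a monotone submodular function, the gain of adding a set is at most the sum of the
marginal gains of its elements. -/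
theorem submodular_gain_le_sum_marginals {V : Type*} [DecidableEq V] (f : Finset V → ℝ)
    (hmono : ∀ A B : Finset V, A ⊆ B → f A ≤ f B)
    (hsub : ∀ A B : Finset V, A ⊆ B → ∀ x : V, x ∉ B →
      f (insert x B) - f B ≤ f (insert x A) - f A)
    (A T : Finset V) :
    f (T ∪ A) - f A ≤ ∑ x ∈ T, (f (insert x A) - f A) := by
  induction T using Finset.induction_on with
  | empty => simp
  | insert x T hx ih =>
    rw [Finset.sum_insert hx, Finset.insert_union]
    by_cases h : x ∈ T ∪ A
    · rw [Finset.insert_eq_self.mpr h]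
      linarith [hmono A (insert x A) (Finset.subset_insert x A)]
    · linarith [hsub A (T ∪ A) Finset.subset_union_right x h]

/-- Geometric-decay recursion for greedy maximization of a monotone submodular
function `f` with `f ∅ = 0`: against any `OPT` with `|OPT| ≤ K`, each greedy
step shrinks the remaining gap by a factor `(1 − 1/K)`, and consequently after
`K` steps `f(OPT) − f(S_K) ≤ (1 − 1/K)^K · f(OPT)`. -/
theorem greedy_geometric_decay {V : Type*} [Fintype V] [DecidableEq V]
    (f : Finset V → ℝ) (hf0 : f ∅ = 0)
    (hmono : ∀ A B : Finset V, A ⊆ B → f A ≤ f B)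
    (hsub : ∀ A B : Finset V, A ⊆ B → ∀ x : V, x ∉ B →
      f (insert x B) - f B ≤ f (insert x A) - f A)
    (K : ℕ) (hK : 1 ≤ K)
    (OPT : Finset V) (hOPT : OPT.card ≤ K)
    (a : ℕ → V) (S : ℕ → Finset V)
    (hS0 : S 0 = ∅)
    (hstep : ∀ t : ℕ, S (t + 1) = insert (a (t + 1)) (S t))
    (hgreedy : ∀ t : ℕ, ∀ b : V,
      f (insert b (S t)) - f (S t) ≤ f (insert (a (t + 1)) (S t)) - f (S t)) :
    (∀ t : ℕ, f OPT - f (S (t + 1)) ≤ (1 - 1 / (K : ℝ)) * (f OPT - f (S t))) ∧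
      f OPT - f (S K) ≤ (1 - 1 / (K : ℝ)) ^ K * f OPT := by
  have hK0 : (0 : ℝ) < K := by exact_mod_cast hK
  have hdecay : ∀ t : ℕ,
      f OPT - f (S (t + 1)) ≤ (1 - 1 / (K : ℝ)) * (f OPT - f (S t)) := by
    intro t
    set g := f (S (t + 1)) - f (S t) with hg
    have hg0 : 0 ≤ g := sub_nonneg.mpr (hmono _ _ (hstep t ▸ Finset.subset_insert _ _))
    have hsum : ∑ x ∈ OPT, (f (insert x (S t)) - f (S t)) ≤ OPT.card * g := by
      rw [← nsmul_eq_mul]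
      exact Finset.sum_le_card_nsmul _ _ _ fun x _ => by
        rw [hg, hstep t]
        exact hgreedy t x
    have hcard : (OPT.card : ℝ) * g ≤ K * g :=
      mul_le_mul_of_nonneg_right (by exact_mod_cast hOPT) hg0
    have hgap : f OPT - f (S t) ≤ K * g := by
      linarith [submodular_gain_le_sum_marginals f hmono hsub (S t) OPT,
        hmono OPT (OPT ∪ S t) Finset.subset_union_left]
    have hdiv : (f OPT - f (S t)) / K ≤ g := (div_le_iff₀' hK0).mpr hgap
    calc f OPT - f (S (t + 1)) = (f OPT - f (S t)) - g := by rw [hg]; ring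
      _ ≤ (f OPT - f (S t)) - (f OPT - f (S t)) / K := by linarith
      _ = (1 - 1 / (K : ℝ)) * (f OPT - f (S t)) := by ring
  have hr : 0 ≤ 1 - 1 / (K : ℝ) :=
    sub_nonneg.mpr ((div_le_one hK0).mpr (by exact_mod_cast hK))
  have hpow : ∀ n : ℕ, f OPT - f (S n) ≤ (1 - 1 / (K : ℝ)) ^ n * f OPT := by
    intro n
    induction n with
    | zero => simp [hS0, hf0]
    | succ n ih =>
      rw [pow_succ', mul_assoc]
      exact (hdecay n).trans (mul_le_mul_of_nonneg_left ih hr)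
  exact ⟨hdecay, hpow K⟩
end
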